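/- Assume each antipode S_α is bijective. Let R be a right ideal of A₁ with R ⊆ ker ε, and let (Γ, d) be the left covariant π-graded first order differential calculus with Γ_α = A_α²/N_α, N_α = r_α⁻¹(A_α ⊗ R), and d_α = π_α ∘ D_α (π_α the canonical quotient map). Then (Γ, d) is bicovariant (i.e. both left and right covariant) if and only if R is π-ad invariant, i.e. ad_α(R) ⊆ R ⊗ A_α for all α ∈ π. -/

import Mathlib

open TensorProduct

/-- The componentwise action of `R ⊗[k] S` on `M ⊗[k] N` induced by `k`-bilinear
actions `f` of `R` on `M` and `g` of `S` on `N`: `(r ⊗ s) • (m ⊗ n) = (f r m) ⊗ (g s n)`. -/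
noncomputable def tact {k : Type} [Field k] {R S M N : Type}
    [AddCommGroup R] [Module k R] [AddCommGroup S] [Module k S]
    [AddCommGroup M] [Module k M] [AddCommGroup N] [Module k N]
    (f : R →ₗ[k] M →ₗ[k] M) (g : S →ₗ[k] N →ₗ[k] N) :
    R ⊗[k] S →ₗ[k] (M ⊗[k] N) →ₗ[k] M ⊗[k] N :=
  TensorProduct.lift (LinearMap.mk₂ k (fun r s => TensorProduct.map (f r) (g s))
    (fun r r' s => by simp only [map_add, TensorProduct.map_add_left])
    (fun c r s => by simp only [map_smul, TensorProduct.map_smul_left])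
    (fun r s s' => by simp only [map_add, TensorProduct.map_add_right])
    (fun r c s => by simp only [map_smul, TensorProduct.map_smul_right]))

/-- `A_α² = ker(m_α : A_α ⊗ A_α → A_α)`. -/
noncomputable def A2sub (k R : Type) [Field k] [Ring R] [Algebra k R] :
    Submodule k (R ⊗[k] R) := LinearMap.ker (LinearMap.mul' k R)

/-- The left `R`-action on `R ⊗ R`: `c • (a ⊗ b) = (c*a) ⊗ b`, as a bilinear map. -/
noncomputable def lmulTb (k R : Type) [Field k] [Ring R] [Algebra k R] :
    R →ₗ[k] (R ⊗[k] R) →ₗ[k] R ⊗[k] R :=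
  (LinearMap.rTensorHom R) ∘ₗ (LinearMap.mul k R)

/-- The right `R`-action on `R ⊗ R`: `(a ⊗ b) • c = a ⊗ (b*c)`, as a bilinear map. -/
noncomputable def rmulTb (k R : Type) [Field k] [Ring R] [Algebra k R] :
    R →ₗ[k] (R ⊗[k] R) →ₗ[k] R ⊗[k] R :=
  (LinearMap.lTensorHom R) ∘ₗ (LinearMap.mul k R).flip

lemma lmulTb_mem_A2sub (k R : Type) [Field k] [Ring R] [Algebra k R]
    (c : R) (q : R ⊗[k] R) (hq : q ∈ A2sub k R) : lmulTb k R c q ∈ A2sub k R := by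
  have h : (LinearMap.mul' k R) ∘ₗ (lmulTb k R c)
      = (LinearMap.mulLeft k c) ∘ₗ (LinearMap.mul' k R) := by
    apply TensorProduct.ext'
    intro x y
    simp [lmulTb, mul_assoc]
  simp only [A2sub, LinearMap.mem_ker] at hq ⊢
  have := LinearMap.congr_fun h q
  simp only [LinearMap.comp_apply] at this
  rw [this, hq]
  simp

lemma rmulTb_mem_A2sub (k R : Type) [Field k] [Ring R] [Algebra k R]
    (c : R) (q : R ⊗[k] R) (hq : q ∈ A2sub k R) : rmulTb k R c q ∈ A2sub k R := by
  have h : (LinearMap.mul' k R) ∘ₗ (rmulTb k R c)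
      = (LinearMap.mulRight k c) ∘ₗ (LinearMap.mul' k R) := by
    apply TensorProduct.ext'
    intro x y
    simp [rmulTb, mul_assoc]
  simp only [A2sub, LinearMap.mem_ker] at hq ⊢
  have := LinearMap.congr_fun h q
  simp only [LinearMap.comp_apply] at this
  rw [this, hq]
  simp

/-- The map `D : R → R ⊗ R`, `D b = 1 ⊗ b - b ⊗ 1`. -/
noncomputable def Dmap (k R : Type) [Field k] [Ring R] [Algebra k R] :
    R →ₗ[k] R ⊗[k] R :=
  (TensorProduct.mk k R R) 1 - (TensorProduct.mk k R R).flip 1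

lemma Dmap_mem_A2sub (k R : Type) [Field k] [Ring R] [Algebra k R] (b : R) :
    Dmap k R b ∈ A2sub k R := by
  simp [Dmap, A2sub, LinearMap.mem_ker]

/-- Descend a bilinear action `act` of `R` on `M` to the quotient `p ⧸ (N ∩ p)` of an
action-stable submodule `p ⊆ M` by an action-stable submodule `N`. -/
noncomputable def descend {k M R : Type} [Field k] [AddCommGroup M] [Module k M]
    [AddCommGroup R] [Module k R]
    (p N : Submodule k M) (act : R →ₗ[k] M →ₗ[k] M)
    (hp : ∀ (c : R), ∀ x ∈ p, act c x ∈ p)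
    (hN : ∀ (c : R), ∀ x ∈ N, act c x ∈ N) :
    R →ₗ[k] (p ⧸ N.comap p.subtype) →ₗ[k] (p ⧸ N.comap p.subtype) where
  toFun c := Submodule.mapQ _ _ ((act c).restrict (hp c))
    (fun x hx => by
      simp only [Submodule.mem_comap, LinearMap.restrict_apply] at hx ⊢
      exact hN c _ hx)
  map_add' c c' := by
    apply Submodule.linearMap_qext
    ext x
    simp only [LinearMap.comp_apply, Submodule.mkQ_apply, Submodule.mapQ_apply,
      LinearMap.add_apply]
    rw [← Submodule.Quotient.mk_add]
    congr 1
    ext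
    simp [LinearMap.restrict_apply, map_add]
  map_smul' t c := by
    apply Submodule.linearMap_qext
    ext x
    simp only [LinearMap.comp_apply, Submodule.mkQ_apply, Submodule.mapQ_apply,
      RingHom.id_apply, LinearMap.smul_apply]
    rw [← Submodule.Quotient.mk_smul]
    congr 1
    ext
    simp [LinearMap.restrict_apply, map_smul]

/-- The differential `d = π ∘ D : R → A²/N` of the quotient first order
differential calculus. -/
noncomputable def dQ (k R : Type) [Field k] [Ring R] [Algebra k R]
    (N : Submodule k (R ⊗[k] R)) :
    R →ₗ[k] ((A2sub k R) ⧸ N.comap (A2sub k R).subtype) :=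
  (N.comap (A2sub k R).subtype).mkQ ∘ₗ
    (LinearMap.codRestrict (A2sub k R) (Dmap k R) (Dmap_mem_A2sub k R))

/-- The left action of `R` on the quotient `A²/N`. -/
noncomputable def lactQ (k R : Type) [Field k] [Ring R] [Algebra k R]
    (N : Submodule k (R ⊗[k] R))
    (hL : ∀ (c : R), ∀ x ∈ N, lmulTb k R c x ∈ N) :
    R →ₗ[k] (A2sub k R ⧸ N.comap (A2sub k R).subtype) →ₗ[k]
      (A2sub k R ⧸ N.comap (A2sub k R).subtype) :=
  descend (A2sub k R) N (lmulTb k R) (lmulTb_mem_A2sub k R) hL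

/-- The right action of `R` on the quotient `A²/N`. -/
noncomputable def ractQ (k R : Type) [Field k] [Ring R] [Algebra k R]
    (N : Submodule k (R ⊗[k] R))
    (hR : ∀ (c : R), ∀ x ∈ N, rmulTb k R c x ∈ N) :
    R →ₗ[k] (A2sub k R ⧸ N.comap (A2sub k R).subtype) →ₗ[k]
      (A2sub k R ⧸ N.comap (A2sub k R).subtype) :=
  descend (A2sub k R) N (rmulTb k R) (rmulTb_mem_A2sub k R) hR

/-- `r_α : A_α ⊗ A_α → A_α ⊗ A₁`, `a ⊗ b ↦ (a ⊗ 1)·Δ_{α,1}(b)`. -/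
noncomputable def rmap {k : Type} [Field k] {G : Type} [Group G]
    (A : G → Type) [∀ α, Ring (A α)] [∀ α, Algebra k (A α)]
    (Δ : ∀ α β γ : G, α * β = γ → (A γ →ₐ[k] A α ⊗[k] A β))
    (α : G) : (A α ⊗[k] A α) →ₗ[k] A α ⊗[k] A 1 :=
  (LinearMap.rTensor (A 1) (LinearMap.mul' k (A α))) ∘ₗ
    (TensorProduct.assoc k (A α) (A α) (A 1)).symm.toLinearMap ∘ₗ
    (LinearMap.lTensor (A α) (Δ α 1 α (mul_one α)).toLinearMap)

/-- `t_α : A_α ⊗ A_α → A₁ ⊗ A_α`, `a ⊗ b ↦ (1 ⊗ a)·Δ_{1,α}(b)`. -/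
noncomputable def tmap {k : Type} [Field k] {G : Type} [Group G]
    (A : G → Type) [∀ α, Ring (A α)] [∀ α, Algebra k (A α)]
    (Δ : ∀ α β γ : G, α * β = γ → (A γ →ₐ[k] A α ⊗[k] A β))
    (α : G) : (A α ⊗[k] A α) →ₗ[k] A 1 ⊗[k] A α :=
  (LinearMap.lTensor (A 1) (LinearMap.mul' k (A α))) ∘ₗ
    (TensorProduct.leftComm k (A α) (A 1) (A α)).toLinearMap ∘ₗ
    (LinearMap.lTensor (A α) (Δ 1 α α (one_mul α)).toLinearMap)

/-- `N_α = r_α⁻¹(A_α ⊗ R)` for a right ideal `R ⊆ A₁`. -/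
noncomputable def NofR {k : Type} [Field k] {G : Type} [Group G]
    (A : G → Type) [∀ α, Ring (A α)] [∀ α, Algebra k (A α)]
    (Δ : ∀ α β γ : G, α * β = γ → (A γ →ₐ[k] A α ⊗[k] A β))
    (Rid : Submodule k (A 1)) (α : G) : Submodule k (A α ⊗[k] A α) :=
  Submodule.comap (rmap A Δ α) (LinearMap.range (LinearMap.lTensor (A α) Rid.subtype))

/-- The adjoint coaction `ad_α : A₁ → A₁ ⊗ A_α`,
`ad_α(a) = Σ a_(2,1) ⊗ S_{α⁻¹}(a_(1,α⁻¹))·a_(3,α)`. -/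
noncomputable def adMap {k : Type} [Field k] {G : Type} [Group G]
    (A : G → Type) [∀ α, Ring (A α)] [∀ α, Algebra k (A α)]
    (Δ : ∀ α β γ : G, α * β = γ → (A γ →ₐ[k] A α ⊗[k] A β))
    (S : ∀ α β : G, α⁻¹ = β → (A α →ₗ[k] A β))
    (α : G) : A 1 →ₗ[k] A 1 ⊗[k] A α :=
  (LinearMap.lTensor (A 1)
      ((LinearMap.mul' k (A α)) ∘ₗ
        (TensorProduct.map (S α⁻¹ α (inv_inv α)) LinearMap.id))) ∘ₗ
    (TensorProduct.leftComm k (A α⁻¹) (A 1) (A α)).toLinearMap ∘ₗ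
    (LinearMap.lTensor (A α⁻¹) (Δ 1 α α (one_mul α)).toLinearMap) ∘ₗ
    (Δ α⁻¹ α 1 (inv_mul_cancel α)).toLinearMap

section QuotientCalculus

variable {k : Type} [Field k]

/-- Tensoring with the projection modulo `p` kills exactly the range of `M ⊗ p`. -/
lemma lTensor_mkQ_eq_zero_iff {M N : Type} [AddCommGroup M] [Module k M] [AddCommGroup N]
    [Module k N] (p : Submodule k N) (t : M ⊗[k] N) :
    LinearMap.lTensor M p.mkQ t = 0 ↔ t ∈ LinearMap.range (LinearMap.lTensor M p.subtype) := by
  rw [← LinearMap.mem_ker, lTensor_mkQ]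

lemma rTensor_mkQ_eq_zero_iff {M N : Type} [AddCommGroup M] [Module k M] [AddCommGroup N]
    [Module k N] (p : Submodule k N) (t : N ⊗[k] M) :
    LinearMap.rTensor M p.mkQ t = 0 ↔ t ∈ LinearMap.range (LinearMap.rTensor M p.subtype) := by
  rw [← LinearMap.mem_ker, rTensor_mkQ]

lemma tact_tmul {R S M N : Type}
    [AddCommGroup R] [Module k R] [AddCommGroup S] [Module k S]
    [AddCommGroup M] [Module k M] [AddCommGroup N] [Module k N]
    (f : R →ₗ[k] M →ₗ[k] M) (g : S →ₗ[k] N →ₗ[k] N) (r : R) (s : S) (m : M) (n : N) :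
    tact f g (r ⊗ₜ s) (m ⊗ₜ n) = f r m ⊗ₜ g s n := by
  simp [tact]

variable {G : Type} [Group G] (A : G → Type) [∀ α, Ring (A α)] [∀ α, Algebra k (A α)]
  (Δ : ∀ α β γ : G, α * β = γ → (A γ →ₐ[k] A α ⊗[k] A β))
  (S : ∀ α β : G, α⁻¹ = β → (A α →ₗ[k] A β))

lemma rmap_tmul (α : G) (a b : A α) :
    rmap A Δ α (a ⊗ₜ b) = (a ⊗ₜ 1) * Δ α 1 α (mul_one α) b := by
  simp only [rmap, LinearMap.comp_apply, LinearMap.lTensor_tmul, AlgHom.toLinearMap_apply,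
    LinearEquiv.coe_coe]
  induction Δ α 1 α (mul_one α) b using TensorProduct.induction_on with
  | zero => simp
  | tmul x y => simp
  | add x y hx hy => simp only [TensorProduct.tmul_add, map_add, mul_add, hx, hy]

/-- The image of `a • D b` under `r_α`. -/
noncomputable def rForm (α : G) (a b : A α) : A α ⊗[k] A 1 :=
  (a ⊗ₜ 1) * Δ α 1 α (mul_one α) b - (a * b) ⊗ₜ 1

lemma rmap_lmulTb_Dmap (α : G) (a b : A α) :
    rmap A Δ α (lmulTb k (A α) a (Dmap k (A α) b)) = rForm A Δ α a b := by
  simp [lmulTb, Dmap, rForm, rmap_tmul]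

variable (Rid : Submodule k (A 1))

/-- The embedding `A_α²/N_α → A_α ⊗ A₁/R` induced by `r_α`. -/
noncomputable def rmapQ (α : G) :
    (A2sub k (A α) ⧸ (NofR A Δ Rid α).comap (A2sub k (A α)).subtype) →ₗ[k]
      A α ⊗[k] (A 1 ⧸ Rid) :=
  Submodule.liftQ _
    (LinearMap.lTensor (A α) Rid.mkQ ∘ₗ rmap A Δ α ∘ₗ (A2sub k (A α)).subtype)
    (fun _ hx => LinearMap.mem_ker.2 ((lTensor_mkQ_eq_zero_iff Rid _).2 hx))

lemma rmapQ_injective (α : G) : Function.Injective (rmapQ A Δ Rid α) := by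
  rw [← LinearMap.ker_eq_bot, rmapQ, Submodule.ker_liftQ_eq_bot]
  intro x hx
  exact (lTensor_mkQ_eq_zero_iff Rid _).1 hx

lemma rmapQ_lactQ_dQ (α : G)
    (hL : ∀ (c : A α), ∀ x ∈ NofR A Δ Rid α, lmulTb k (A α) c x ∈ NofR A Δ Rid α)
    (a b : A α) :
    rmapQ A Δ Rid α (lactQ k (A α) (NofR A Δ Rid α) hL a (dQ k (A α) (NofR A Δ Rid α) b))
      = LinearMap.lTensor (A α) Rid.mkQ (rForm A Δ α a b) := by
  rw [← rmap_lmulTb_Dmap]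
  rfl

/-- The algebra map `(Δ_{α,β} ⊗ id) : A_{αβ} ⊗ A₁ → A_α ⊗ (A_β ⊗ A₁)`. -/
noncomputable def leftTransfer (α β γ : G) (h : α * β = γ) :
    A γ ⊗[k] A 1 →ₐ[k] A α ⊗[k] (A β ⊗[k] A 1) :=
  (Algebra.TensorProduct.assoc k k k (A α) (A β) (A 1)).toAlgHom.comp
    (Algebra.TensorProduct.map (Δ α β γ h) (AlgHom.id k (A 1)))

/-- The embedding `p ⊗ q ↦ p ⊗ (1 ⊗ q)`. -/
noncomputable def midUnit (α β : G) : A α ⊗[k] A β →ₐ[k] A α ⊗[k] (A 1 ⊗[k] A β) :=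
  Algebra.TensorProduct.map (AlgHom.id k (A α)) Algebra.TensorProduct.includeRight

/-- The map `a ⊗ x ↦ (a₁ ⊗ 1 ⊗ a₂) (1 ⊗ ad_β x)`. -/
noncomputable def rightTransfer (α β γ : G) (h : α * β = γ) :
    A γ ⊗[k] A 1 →ₗ[k] A α ⊗[k] (A 1 ⊗[k] A β) :=
  LinearMap.mul' k _ ∘ₗ TensorProduct.map
    ((midUnit A α β).toLinearMap ∘ₗ (Δ α β γ h).toLinearMap)
    (TensorProduct.mk k (A α) (A 1 ⊗[k] A β) 1 ∘ₗ adMap A Δ S β)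

lemma rightTransfer_tmul (α β γ : G) (h : α * β = γ) (a : A γ) (x : A 1) :
    rightTransfer A Δ S α β γ h (a ⊗ₜ x)
      = midUnit A α β (Δ α β γ h a) * (1 ⊗ₜ adMap A Δ S β x) := rfl

/-- Coassociativity, with the products of indices allowed to vary propositionally. -/
def Coassoc : Prop :=
  ∀ (α β γ δ ζ η : G) (h₁ : α * β = δ) (h₂ : δ * γ = η) (h₃ : β * γ = ζ) (h₄ : α * ζ = η)
    (x : A η),
    TensorProduct.assoc k (A α) (A β) (A γ)
        (Algebra.TensorProduct.map (Δ α β δ h₁) (AlgHom.id k (A γ)) (Δ δ γ η h₂ x))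
      = Algebra.TensorProduct.map (AlgHom.id k (A α)) (Δ β γ ζ h₃) (Δ α ζ η h₄ x)

variable {A Δ S}

lemma leftTransfer_rForm (hc : Coassoc A Δ) (α β γ : G) (h : α * β = γ) (a b : A γ) :
    leftTransfer A Δ α β γ h (rForm A Δ γ a b)
      = TensorProduct.assoc k (A α) (A β) (A 1) (Δ α β γ h a ⊗ₜ 1)
          * Algebra.TensorProduct.map (AlgHom.id k (A α)) (Δ β 1 β (mul_one β)) (Δ α β γ h b)
        - TensorProduct.assoc k (A α) (A β) (A 1) ((Δ α β γ h a * Δ α β γ h b) ⊗ₜ 1) := by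
  rw [← hc α β 1 γ β γ h (mul_one γ) (mul_one β) h]
  simp only [rForm, map_sub, map_mul]
  simp [leftTransfer]
  rfl

/-- `Δ_{1,β}(c) = Σ (1 ⊗ c₁) ad_β(c₂)`. -/
lemma coproduct_eq_mul_adMap (hc : Coassoc A Δ) (ε : A 1 →ₐ[k] k)
    (hcounit₂ : ∀ (α : G) (x : A α),
      (TensorProduct.lid k (A α)) ((LinearMap.rTensor (A α) ε.toLinearMap)
        ((Δ 1 α α (one_mul α)) x)) = x)
    (hantipode₂ : ∀ (α : G) (x : A 1),
      (LinearMap.mul' k (A α)) ((LinearMap.lTensor (A α) (S α⁻¹ α (inv_inv α)))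
        ((Δ α α⁻¹ 1 (mul_inv_cancel α)) x)) = ε x • 1)
    (β : G) (c : A β) :
    LinearMap.mul' k (A 1 ⊗[k] A β)
        (TensorProduct.map (TensorProduct.mk k (A 1) (A β) 1) (adMap A Δ S β)
          (Δ β 1 β (mul_one β) c))
      = Δ 1 β β (one_mul β) c := by
  let F : A β⁻¹ ⊗[k] A β →ₗ[k] A 1 ⊗[k] A β :=
    (LinearMap.lTensor (A 1)
      (LinearMap.mul' k (A β) ∘ₗ TensorProduct.map (S β⁻¹ β (inv_inv β)) LinearMap.id)) ∘ₗ
    (TensorProduct.leftComm k (A β⁻¹) (A 1) (A β)).toLinearMap ∘ₗ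
    (LinearMap.lTensor (A β⁻¹) (Δ 1 β β (one_mul β)).toLinearMap)
  have hF : adMap A Δ S β = F ∘ₗ (Δ β⁻¹ β 1 (inv_mul_cancel β)).toLinearMap := rfl
  let K : A β ⊗[k] (A β⁻¹ ⊗[k] A β) →ₗ[k] A 1 ⊗[k] A β :=
    LinearMap.mul' k (A 1 ⊗[k] A β) ∘ₗ
      TensorProduct.map (TensorProduct.mk k (A 1) (A β) 1) F
  have h1 : ∀ T : A β ⊗[k] A 1,
      LinearMap.mul' k (A 1 ⊗[k] A β)
        (TensorProduct.map (TensorProduct.mk k (A 1) (A β) 1) (adMap A Δ S β) T)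
      = K (Algebra.TensorProduct.map (AlgHom.id k (A β))
          (Δ β⁻¹ β 1 (inv_mul_cancel β)) T) := by
    intro T
    induction T using TensorProduct.induction_on with
    | zero => simp
    | tmul x y => simp [K, hF]
    | add x y hx hy => simp only [map_add, hx, hy]
  have h2 : ∀ (P : A β ⊗[k] A β⁻¹) (z : A β),
      K (TensorProduct.assoc k _ _ _ (P ⊗ₜ z))
        = (1 ⊗ₜ LinearMap.mul' k (A β) (LinearMap.lTensor (A β) (S β⁻¹ β (inv_inv β)) P))
          * Δ 1 β β (one_mul β) z := by
    intro P z
    induction P using TensorProduct.induction_on with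
    | zero => simp
    | add x y hx hy =>
      simp only [TensorProduct.add_tmul, TensorProduct.tmul_add, map_add, add_mul, hx, hy]
    | tmul t u =>
      simp only [K, F, TensorProduct.assoc_tmul, LinearMap.comp_apply, TensorProduct.map_tmul,
        LinearMap.lTensor_tmul, LinearMap.mul'_apply, TensorProduct.mk_apply,
        AlgHom.toLinearMap_apply, LinearEquiv.coe_coe]
      induction Δ 1 β β (one_mul β) z using TensorProduct.induction_on with
      | zero => simp
      | tmul x y => simp [mul_assoc]
      | add x y hx hy => simp only [TensorProduct.tmul_add, map_add, mul_add, hx, hy]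
  have h3 : ∀ T : A 1 ⊗[k] A β,
      K (TensorProduct.assoc k _ _ _
        (Algebra.TensorProduct.map (Δ β β⁻¹ 1 (mul_inv_cancel β)) (AlgHom.id k (A β)) T))
      = Δ 1 β β (one_mul β) (TensorProduct.lid k (A β)
          (LinearMap.rTensor (A β) ε.toLinearMap T)) := by
    intro T
    induction T using TensorProduct.induction_on with
    | zero => simp
    | tmul x y =>
      simp only [Algebra.TensorProduct.map_tmul, AlgHom.id_apply, h2, hantipode₂]
      simp [TensorProduct.tmul_smul, ← Algebra.TensorProduct.one_def]
    | add x y hx hy => simp only [map_add, hx, hy]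
  rw [h1, ← hc β β⁻¹ β 1 1 β (mul_inv_cancel β) (one_mul β) (inv_mul_cancel β) (mul_one β), h3,
    hcounit₂]

lemma rightTransfer_mul_coproduct (hc : Coassoc A Δ)
    (had : ∀ (β : G) (c : A β), LinearMap.mul' k (A 1 ⊗[k] A β)
        (TensorProduct.map (TensorProduct.mk k (A 1) (A β) 1) (adMap A Δ S β)
          (Δ β 1 β (mul_one β) c))
      = Δ 1 β β (one_mul β) c)
    (α β γ : G) (h : α * β = γ) (a b : A γ) :
    rightTransfer A Δ S α β γ h ((a ⊗ₜ 1) * Δ γ 1 γ (mul_one γ) b)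
      = midUnit A α β (Δ α β γ h a) *
        Algebra.TensorProduct.map (AlgHom.id k (A α)) (Δ 1 β β (one_mul β)) (Δ α β γ h b) := by
  let K : A α ⊗[k] (A β ⊗[k] A 1) →ₗ[k] A α ⊗[k] (A 1 ⊗[k] A β) :=
    LinearMap.lTensor (A α) (LinearMap.mul' k (A 1 ⊗[k] A β) ∘ₗ
      TensorProduct.map (TensorProduct.mk k (A 1) (A β) 1) (adMap A Δ S β))
  have h1 : ∀ (P : A α ⊗[k] A β) (x : A 1),
      midUnit A α β P * (1 ⊗ₜ adMap A Δ S β x) = K (TensorProduct.assoc k _ _ _ (P ⊗ₜ x)) := by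
    intro P x
    induction P using TensorProduct.induction_on with
    | zero => simp
    | tmul u v => simp [midUnit, K]
    | add x y hx hy => simp only [TensorProduct.add_tmul, map_add, add_mul, hx, hy]
  have h2 : ∀ T : A γ ⊗[k] A 1,
      rightTransfer A Δ S α β γ h ((a ⊗ₜ 1) * T)
      = midUnit A α β (Δ α β γ h a) * K (TensorProduct.assoc k _ _ _
        (Algebra.TensorProduct.map (Δ α β γ h) (AlgHom.id k (A 1)) T)) := by
    intro T
    induction T using TensorProduct.induction_on with
    | zero => simp
    | tmul x y =>
      simp only [Algebra.TensorProduct.tmul_mul_tmul, one_mul, rightTransfer_tmul, map_mul,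
        mul_assoc, h1, Algebra.TensorProduct.map_tmul, AlgHom.id_apply]
    | add x y hx hy => simp only [map_add, mul_add, hx, hy]
  have h3 : ∀ T : A α ⊗[k] A β,
      K (Algebra.TensorProduct.map (AlgHom.id k (A α)) (Δ β 1 β (mul_one β)) T)
      = Algebra.TensorProduct.map (AlgHom.id k (A α)) (Δ 1 β β (one_mul β)) T := by
    intro T
    induction T using TensorProduct.induction_on with
    | zero => simp
    | tmul x y => simp [K, had]
    | add x y hx hy => simp only [map_add, hx, hy]
  rw [h2, hc α β 1 γ β γ h (mul_one γ) (mul_one β) h, h3]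

lemma rightTransfer_rForm (hc : Coassoc A Δ)
    (had : ∀ (β : G) (c : A β), LinearMap.mul' k (A 1 ⊗[k] A β)
        (TensorProduct.map (TensorProduct.mk k (A 1) (A β) 1) (adMap A Δ S β)
          (Δ β 1 β (mul_one β) c))
      = Δ 1 β β (one_mul β) c)
    (α β γ : G) (h : α * β = γ) (a b : A γ) :
    rightTransfer A Δ S α β γ h (rForm A Δ γ a b)
      = midUnit A α β (Δ α β γ h a) * TensorProduct.assoc k (A α) (A 1) (A β)
          (Algebra.TensorProduct.map (Δ α 1 α (mul_one α)) (AlgHom.id k (A β)) (Δ α β γ h b))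
        - midUnit A α β (Δ α β γ h a * Δ α β γ h b) := by
  have h1 := rightTransfer_mul_coproduct hc had α β γ h a b
  have h2 := rightTransfer_mul_coproduct hc had α β γ h (a * b) 1
  simp only [map_one, mul_one, map_mul] at h2
  rw [rForm, map_sub, h1, h2, hc α 1 β α β γ (mul_one α) h (one_mul β) h, map_mul]

lemma lTensor_rmapQ_tact (hc : Coassoc A Δ)
    (hL : ∀ (α : G) (c : A α), ∀ x ∈ NofR A Δ Rid α, lmulTb k (A α) c x ∈ NofR A Δ Rid α)
    (α β γ : G) (h : α * β = γ) (a b : A γ) :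
    LinearMap.lTensor (A α) (rmapQ A Δ Rid β)
        (tact (LinearMap.mul k (A α)) (lactQ k (A β) (NofR A Δ Rid β) (hL β)) (Δ α β γ h a)
          (LinearMap.lTensor (A α) (dQ k (A β) (NofR A Δ Rid β)) (Δ α β γ h b)))
      = LinearMap.lTensor (A α) (LinearMap.lTensor (A β) Rid.mkQ)
          (leftTransfer A Δ α β γ h (rForm A Δ γ a b)) := by
  rw [leftTransfer_rForm hc]
  generalize Δ α β γ h a = X
  generalize Δ α β γ h b = Y
  induction X using TensorProduct.induction_on with
  | zero => simp
  | add x y hx hy =>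
    simp only [map_add, LinearMap.add_apply, hx, hy, TensorProduct.add_tmul, add_mul, map_sub]
    abel
  | tmul p q =>
    induction Y using TensorProduct.induction_on with
    | zero => simp
    | add x y hx hy =>
      simp only [map_add, hx, hy, TensorProduct.add_tmul, mul_add, map_sub]
      abel
    | tmul u v =>
      simp [tact_tmul, rmapQ_lactQ_dQ, rForm, TensorProduct.tmul_sub]

lemma rTensor_rmapQ_tact (hc : Coassoc A Δ)
    (had : ∀ (β : G) (c : A β), LinearMap.mul' k (A 1 ⊗[k] A β)
        (TensorProduct.map (TensorProduct.mk k (A 1) (A β) 1) (adMap A Δ S β)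
          (Δ β 1 β (mul_one β) c))
      = Δ 1 β β (one_mul β) c)
    (hL : ∀ (α : G) (c : A α), ∀ x ∈ NofR A Δ Rid α, lmulTb k (A α) c x ∈ NofR A Δ Rid α)
    (α β γ : G) (h : α * β = γ) (a b : A γ) :
    TensorProduct.assoc k (A α) (A 1 ⧸ Rid) (A β)
      (LinearMap.rTensor (A β) (rmapQ A Δ Rid α)
        (tact (lactQ k (A α) (NofR A Δ Rid α) (hL α)) (LinearMap.mul k (A β)) (Δ α β γ h a)
          (LinearMap.rTensor (A β) (dQ k (A α) (NofR A Δ Rid α)) (Δ α β γ h b))))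
      = LinearMap.lTensor (A α) (LinearMap.rTensor (A β) Rid.mkQ)
          (rightTransfer A Δ S α β γ h (rForm A Δ γ a b)) := by
  rw [rightTransfer_rForm hc had]
  generalize Δ α β γ h a = X
  generalize Δ α β γ h b = Y
  induction X using TensorProduct.induction_on with
  | zero => simp
  | add x y hx hy =>
    simp only [map_add, LinearMap.add_apply, hx, hy, add_mul, map_sub]
    abel
  | tmul p q =>
    induction Y using TensorProduct.induction_on with
    | zero => simp
    | add x y hx hy =>
      simp only [map_add, hx, hy, mul_add, map_sub]
      abel
    | tmul u v =>
      have key : ∀ T : A α ⊗[k] A 1,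
          TensorProduct.assoc k (A α) (A 1 ⧸ Rid) (A β)
            (LinearMap.lTensor (A α) Rid.mkQ ((p ⊗ₜ 1) * T) ⊗ₜ (q * v))
          = LinearMap.lTensor (A α) (LinearMap.rTensor (A β) Rid.mkQ)
            ((p ⊗ₜ (1 ⊗ₜ q)) * TensorProduct.assoc k (A α) (A 1) (A β) (T ⊗ₜ v)) := by
        intro T
        induction T using TensorProduct.induction_on with
        | zero => simp
        | tmul x y => simp
        | add x y hx hy => simp only [map_add, mul_add, TensorProduct.add_tmul, hx, hy]
      simp [tact_tmul, rmapQ_lactQ_dQ, rForm, TensorProduct.sub_tmul, key, midUnit]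

lemma lTensor_mkQ_leftTransfer_eq_zero (α β γ : G) (h : α * β = γ) {t : A γ ⊗[k] A 1}
    (ht : LinearMap.lTensor (A γ) Rid.mkQ t = 0) :
    LinearMap.lTensor (A α) (LinearMap.lTensor (A β) Rid.mkQ) (leftTransfer A Δ α β γ h t)
      = 0 := by
  have key : ∀ t : A γ ⊗[k] A 1,
      LinearMap.lTensor (A α) (LinearMap.lTensor (A β) Rid.mkQ) (leftTransfer A Δ α β γ h t)
      = TensorProduct.assoc k _ _ _ (LinearMap.rTensor (A 1 ⧸ Rid) (Δ α β γ h).toLinearMap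
          (LinearMap.lTensor (A γ) Rid.mkQ t)) := by
    intro t
    induction t using TensorProduct.induction_on with
    | zero => simp
    | add x y hx hy => simp only [map_add, hx, hy]
    | tmul x y =>
      simp only [leftTransfer, AlgHom.comp_apply, Algebra.TensorProduct.map_tmul,
        AlgHom.id_apply, LinearMap.lTensor_tmul, LinearMap.rTensor_tmul,
        AlgHom.toLinearMap_apply]
      induction Δ α β γ h x using TensorProduct.induction_on with
      | zero => simp
      | tmul x y => simp
      | add x y hx hy => simp only [map_add, TensorProduct.add_tmul, hx, hy]
  rw [key, ht]
  simp

lemma lTensor_mkQ_rightTransfer_eq_zero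
    (hinv : ∀ (α : G), ∀ x ∈ Rid,
      adMap A Δ S α x ∈ LinearMap.range (LinearMap.rTensor (A α) Rid.subtype))
    (α β γ : G) (h : α * β = γ) {t : A γ ⊗[k] A 1}
    (ht : LinearMap.lTensor (A γ) Rid.mkQ t = 0) :
    LinearMap.lTensor (A α) (LinearMap.rTensor (A β) Rid.mkQ) (rightTransfer A Δ S α β γ h t)
      = 0 := by
  obtain ⟨s, rfl⟩ := (lTensor_mkQ_eq_zero_iff Rid _).1 ht
  clear ht
  have key : ∀ (q : A β) (w : A 1 ⊗[k] A β),
      LinearMap.rTensor (A β) Rid.mkQ ((1 ⊗ₜ q) * w)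
      = LinearMap.lTensor (A 1 ⧸ Rid) (LinearMap.mulLeft k q)
          (LinearMap.rTensor (A β) Rid.mkQ w) := by
    intro q w
    induction w using TensorProduct.induction_on with
    | zero => simp
    | tmul x y => simp
    | add x y hx hy => simp only [map_add, mul_add, hx, hy]
  induction s using TensorProduct.induction_on with
  | zero => simp
  | add x y hx hy => simp only [map_add, hx, hy, add_zero]
  | tmul c x =>
    have hx := (rTensor_mkQ_eq_zero_iff Rid _).2 (hinv β x x.2)
    simp only [LinearMap.lTensor_tmul, Submodule.subtype_apply, rightTransfer_tmul]
    induction Δ α β γ h c using TensorProduct.induction_on with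
    | zero => simp
    | tmul p q => simp [midUnit, key, hx]
    | add x y hx hy => simp only [map_add, add_mul, hx, hy, add_zero]

/-- `r_β(S(x₁) ⊗ x₂) = 1 ⊗ x`. -/
lemma rmap_antipode (hc : Coassoc A Δ) (ε : A 1 →ₐ[k] k)
    (hcounit₂ : ∀ (α : G) (x : A α),
      (TensorProduct.lid k (A α)) ((LinearMap.rTensor (A α) ε.toLinearMap)
        ((Δ 1 α α (one_mul α)) x)) = x)
    (hantipode₁ : ∀ (α : G) (x : A 1),
      (LinearMap.mul' k (A α)) ((LinearMap.rTensor (A α) (S α⁻¹ α (inv_inv α)))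
        ((Δ α⁻¹ α 1 (inv_mul_cancel α)) x)) = ε x • 1)
    (β : G) (x : A 1) :
    rmap A Δ β (LinearMap.rTensor (A β) (S β⁻¹ β (inv_inv β))
      (Δ β⁻¹ β 1 (inv_mul_cancel β) x)) = 1 ⊗ₜ x := by
  let K : A β⁻¹ ⊗[k] (A β ⊗[k] A 1) →ₗ[k] A β ⊗[k] A 1 :=
    LinearMap.rTensor (A 1) (LinearMap.mul' k (A β) ∘ₗ
      LinearMap.rTensor (A β) (S β⁻¹ β (inv_inv β))) ∘ₗ
      (TensorProduct.assoc k (A β⁻¹) (A β) (A 1)).symm.toLinearMap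
  have h1 : ∀ T : A β⁻¹ ⊗[k] A β,
      rmap A Δ β (LinearMap.rTensor (A β) (S β⁻¹ β (inv_inv β)) T)
      = K (Algebra.TensorProduct.map (AlgHom.id k (A β⁻¹)) (Δ β 1 β (mul_one β)) T) := by
    intro T
    induction T using TensorProduct.induction_on with
    | zero => simp
    | add x y hx hy => simp only [map_add, hx, hy]
    | tmul x y =>
      simp only [LinearMap.rTensor_tmul, rmap_tmul, Algebra.TensorProduct.map_tmul,
        AlgHom.id_apply]
      induction Δ β 1 β (mul_one β) y using TensorProduct.induction_on with
      | zero => simp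
      | tmul x y => simp [K]
      | add x y hx hy => simp only [map_add, mul_add, TensorProduct.tmul_add, hx, hy]
  have h2 : ∀ T : A 1 ⊗[k] A 1,
      K (TensorProduct.assoc k _ _ _
        (Algebra.TensorProduct.map (Δ β⁻¹ β 1 (inv_mul_cancel β)) (AlgHom.id k (A 1)) T))
      = 1 ⊗ₜ TensorProduct.lid k (A 1) (LinearMap.rTensor (A 1) ε.toLinearMap T) := by
    intro T
    induction T using TensorProduct.induction_on with
    | zero => simp
    | tmul x y => simp [K, hantipode₁, TensorProduct.smul_tmul]
    | add x y hx hy => simp only [map_add, TensorProduct.tmul_add, hx, hy]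
  rw [h1, ← hc β⁻¹ β 1 1 β 1 (inv_mul_cancel β) (mul_one 1) (mul_one β) (inv_mul_cancel β), h2,
    hcounit₂]

end QuotientCalculus

/-- Let `R ⊆ ker ε` be a right ideal of `A₁` and `(Γ, d)` the left
covariant first order differential calculus with `Γ_α = A_α²/N_α`,
`N_α = r_α⁻¹(A_α ⊗ R)`, `d_α = π_α ∘ D_α` (antipodes assumed bijective). Then `(Γ, d)`
is bicovariant if and only if `R` is `π`-ad invariant. -/
theorem quotient_fodc_bicovariant_iff_ad_invariant
    {k : Type} [Field k] {G : Type} [Group G]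
    (A : G → Type) [∀ α, Ring (A α)] [∀ α, Algebra k (A α)]
    (Δ : ∀ α β γ : G, α * β = γ → (A γ →ₐ[k] A α ⊗[k] A β))
    (ε : A 1 →ₐ[k] k)
    (S : ∀ α β : G, α⁻¹ = β → (A α →ₗ[k] A β))
    (hcoassoc : ∀ (α β γ : G) (x : A (α * β * γ)),
      (TensorProduct.assoc k (A α) (A β) (A γ))
          ((Algebra.TensorProduct.map (Δ α β (α * β) rfl) (AlgHom.id k (A γ)))
            ((Δ (α * β) γ (α * β * γ) rfl) x))
        = (Algebra.TensorProduct.map (AlgHom.id k (A α)) (Δ β γ (β * γ) rfl))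
            ((Δ α (β * γ) (α * β * γ) (mul_assoc α β γ).symm) x))
    (hcounit₁ : ∀ (α : G) (x : A α),
      (TensorProduct.rid k (A α)) ((LinearMap.lTensor (A α) ε.toLinearMap)
        ((Δ α 1 α (mul_one α)) x)) = x)
    (hcounit₂ : ∀ (α : G) (x : A α),
      (TensorProduct.lid k (A α)) ((LinearMap.rTensor (A α) ε.toLinearMap)
        ((Δ 1 α α (one_mul α)) x)) = x)
    (hantipode₁ : ∀ (α : G) (x : A 1),
      (LinearMap.mul' k (A α)) ((LinearMap.rTensor (A α) (S α⁻¹ α (inv_inv α)))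
        ((Δ α⁻¹ α 1 (inv_mul_cancel α)) x)) = ε x • 1)
    (hantipode₂ : ∀ (α : G) (x : A 1),
      (LinearMap.mul' k (A α)) ((LinearMap.lTensor (A α) (S α⁻¹ α (inv_inv α)))
        ((Δ α α⁻¹ 1 (mul_inv_cancel α)) x)) = ε x • 1)
    (hS : ∀ α : G, Function.Bijective (S α α⁻¹ rfl))
    (Rid : Submodule k (A 1))
    (hRid_ideal : ∀ x ∈ Rid, ∀ a : A 1, x * a ∈ Rid)
    (hRid_ker : ∀ x ∈ Rid, ε x = 0)
    (hle : ∀ α : G, NofR A Δ Rid α ≤ A2sub k (A α))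
    (hL : ∀ (α : G) (c : A α), ∀ x ∈ NofR A Δ Rid α,
      lmulTb k (A α) c x ∈ NofR A Δ Rid α)
    (hR : ∀ (α : G) (c : A α), ∀ x ∈ NofR A Δ Rid α,
      rmulTb k (A α) c x ∈ NofR A Δ Rid α) :
    ((∀ (α β : G) (n : ℕ) (a b : Fin n → A (α * β)),
        (∑ i, lactQ k (A (α * β)) (NofR A Δ Rid (α * β)) (hL (α * β)) (a i)
          (dQ k (A (α * β)) (NofR A Δ Rid (α * β)) (b i))) = 0 →
        (∑ i, tact (LinearMap.mul k (A α)) (lactQ k (A β) (NofR A Δ Rid β) (hL β))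
            ((Δ α β (α * β) rfl) (a i))
            ((LinearMap.lTensor (A α) (dQ k (A β) (NofR A Δ Rid β)))
              ((Δ α β (α * β) rfl) (b i)))) = 0)
      ∧ (∀ (α β : G) (n : ℕ) (a b : Fin n → A (α * β)),
        (∑ i, lactQ k (A (α * β)) (NofR A Δ Rid (α * β)) (hL (α * β)) (a i)
          (dQ k (A (α * β)) (NofR A Δ Rid (α * β)) (b i))) = 0 →
        (∑ i, tact (lactQ k (A α) (NofR A Δ Rid α) (hL α)) (LinearMap.mul k (A β))
            ((Δ α β (α * β) rfl) (a i))
            ((LinearMap.rTensor (A β) (dQ k (A α) (NofR A Δ Rid α)))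
              ((Δ α β (α * β) rfl) (b i)))) = 0))
    ↔ (∀ (α : G), ∀ x ∈ Rid,
        adMap A Δ S α x ∈ LinearMap.range (LinearMap.rTensor (A α) Rid.subtype)) := by
  have hc : Coassoc A Δ := by
    rintro α β γ _ _ _ rfl rfl rfl h₄ x
    exact hcoassoc α β γ x
  have had := coproduct_eq_mul_adMap hc ε hcounit₂ hantipode₂
  have hzero : ∀ (γ : G) (n : ℕ) (a b : Fin n → A γ),
      (∑ i, lactQ k (A γ) (NofR A Δ Rid γ) (hL γ) (a i) (dQ k (A γ) (NofR A Δ Rid γ) (b i)))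
        = 0 ↔ LinearMap.lTensor (A γ) Rid.mkQ (∑ i, rForm A Δ γ (a i) (b i)) = 0 := by
    intro γ n a b
    rw [← map_eq_zero_iff _ (rmapQ_injective A Δ Rid γ), map_sum, map_sum]
    simp only [rmapQ_lactQ_dQ]
  have hright : ∀ (α β γ : G) (h : α * β = γ) (n : ℕ) (a b : Fin n → A γ),
      (∑ i, tact (lactQ k (A α) (NofR A Δ Rid α) (hL α)) (LinearMap.mul k (A β))
          (Δ α β γ h (a i))
          (LinearMap.rTensor (A β) (dQ k (A α) (NofR A Δ Rid α)) (Δ α β γ h (b i)))) = 0 ↔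
      LinearMap.lTensor (A α) (LinearMap.rTensor (A β) Rid.mkQ)
        (rightTransfer A Δ S α β γ h (∑ i, rForm A Δ γ (a i) (b i))) = 0 := by
    intro α β γ h n a b
    rw [← map_eq_zero_iff _ (Module.Flat.rTensor_preserves_injective_linearMap (M := A β) _
        (rmapQ_injective A Δ Rid α)),
      ← LinearEquiv.map_eq_zero_iff (TensorProduct.assoc k (A α) (A 1 ⧸ Rid) (A β))]
    simp only [map_sum, rTensor_rmapQ_tact Rid hc had hL]
  constructor
  · rintro ⟨-, hcov⟩ β x hx
    have hcov' : ∀ (α β γ : G) (h : α * β = γ) (n : ℕ) (a b : Fin n → A γ),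
        LinearMap.lTensor (A γ) Rid.mkQ (∑ i, rForm A Δ γ (a i) (b i)) = 0 →
        LinearMap.lTensor (A α) (LinearMap.rTensor (A β) Rid.mkQ)
          (rightTransfer A Δ S α β γ h (∑ i, rForm A Δ γ (a i) (b i))) = 0 := by
      rintro α β _ rfl n a b h0
      exact (hright α β _ rfl n a b).1 (hcov α β n a b ((hzero _ n a b).2 h0))
    set q := LinearMap.rTensor (A β) (S β⁻¹ β (inv_inv β)) (Δ β⁻¹ β 1 (inv_mul_cancel β) x)
      with hq
    have hrq : rmap A Δ β q = 1 ⊗ₜ x := rmap_antipode hc ε hcounit₂ hantipode₁ β x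
    have hqN : q ∈ NofR A Δ Rid β := by
      change rmap A Δ β q ∈ LinearMap.range (LinearMap.lTensor (A β) Rid.subtype)
      rw [hrq]
      exact ⟨1 ⊗ₜ ⟨x, hx⟩, by simp⟩
    have hq0 : LinearMap.mul' k (A β) q = 0 := hle β hqN
    obtain ⟨n, a, b, hab⟩ : ∃ (n : ℕ) (a b : Fin n → A β), q = ∑ i, a i ⊗ₜ b i := by
      obtain ⟨s, hs⟩ := TensorProduct.exists_finset q
      refine ⟨s.card, fun i => (s.equivFin.symm i).1.1, fun i => (s.equivFin.symm i).1.2, ?_⟩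
      rw [hs, ← Finset.sum_coe_sort, ← s.equivFin.symm.sum_comp]
    have hsum : ∑ i, rForm A Δ β (a i) (b i) = 1 ⊗ₜ x := by
      rw [hab] at hrq hq0
      simp only [map_sum, rmap_tmul, LinearMap.mul'_apply] at hrq hq0
      simp only [rForm, Finset.sum_sub_distrib, ← TensorProduct.sum_tmul, hrq, hq0,
        TensorProduct.zero_tmul, sub_zero]
    have h0 := hcov' 1 β β (one_mul β) n a b (by
      rw [hsum, LinearMap.lTensor_tmul, Submodule.mkQ_apply,
        (Submodule.Quotient.mk_eq_zero Rid).2 hx, TensorProduct.tmul_zero])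
    rw [hsum, rightTransfer_tmul, map_one, map_one, one_mul, LinearMap.lTensor_tmul] at h0
    have h1 := congrArg (fun t => TensorProduct.lid k _ (LinearMap.rTensor _ ε.toLinearMap t)) h0
    rw [← rTensor_mkQ_eq_zero_iff]
    simpa using h1
  · intro hinv
    refine ⟨fun α β n a b h0 => ?_, fun α β n a b h0 => ?_⟩
    · rw [hzero] at h0
      rw [← map_eq_zero_iff _ (Module.Flat.lTensor_preserves_injective_linearMap (M := A α) _
        (rmapQ_injective A Δ Rid β))]
      simp only [map_sum, lTensor_rmapQ_tact Rid hc hL]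
      simpa only [map_sum] using lTensor_mkQ_leftTransfer_eq_zero Rid α β _ rfl h0
    · rw [hzero] at h0
      rw [hright]
      exact lTensor_mkQ_rightTransfer_eq_zero Rid hinv α β _ rfl h0
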